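/- Let K be a complete nonarchimedean field of mixed characteristic (0,p), q a power of p, and let A_1(K)^† = {Σ_{l,k≥0} a_{l,k} x^l ∂^{[k]} : ∃C>0, ∃η<1, |a_{l,k}| < Cη^{l+k}} (with ∂^{[k]} = ∂^k/k!). Suppose |π| = p^{-1/(p-1)}, the α_i ∈ (1/(q-1))ℤ are non-integers, and the β_j ∈ (1/(q-1))ℤ. If a sequence (c_l)_{l≥0} in K satisfies |c_l| < Cη^l for all l (some C>0, η<1) and the recursion c_l·∏_{i=1}^m(l-α_i) = (-1)^{m+np} π^{m-n} c_{l+1}·∏_{j=1}^n(l-β_j) for all l ≥ 0, then c_l = 0 for all l. -/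

import Mathlib

open scoped BigOperators

section Ultrametric

variable {K : Type*} [NormedField K] [IsUltrametricDist K] {p : ℕ}

theorem norm_natCast_eq_one_of_coprime (hpK : ‖(p : K)‖ < 1) {u : ℕ} (hu : Nat.Coprime u p) :
    ‖(u : K)‖ = 1 := by
  refine le_antisymm (IsUltrametricDist.norm_natCast_le_one K u) ?_
  obtain ⟨a, b, hab⟩ := Nat.isCoprime_iff_coprime.mpr hu
  have h1 : (a : K) * u + b * p = 1 := by exact_mod_cast congrArg (Int.cast : ℤ → K) hab
  by_contra! hlt
  have h2 : ‖(a : K) * u + b * p‖ < 1 := by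
    refine (IsUltrametricDist.norm_add_le_max _ _).trans_lt (max_lt ?_ ?_) <;> rw [norm_mul]
    · exact (mul_le_of_le_one_left (norm_nonneg _)
        (IsUltrametricDist.norm_intCast_le_one K a)).trans_lt hlt
    · exact (mul_le_of_le_one_left (norm_nonneg _)
        (IsUltrametricDist.norm_intCast_le_one K b)).trans_lt hpK
  rw [h1, norm_one] at h2
  exact lt_irrefl _ h2

theorem norm_natCast_eq_inv_pow_padicValNat (hp : p.Prime) (hpK : ‖(p : K)‖ = (p : ℝ)⁻¹)
    {N : ℕ} (hN : N ≠ 0) : ‖(N : K)‖ = ((p : ℝ)⁻¹) ^ padicValNat p N := by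
  have hlt : ‖(p : K)‖ < 1 := by
    rw [hpK]; exact inv_lt_one_of_one_lt₀ (by exact_mod_cast hp.one_lt)
  have hu := norm_natCast_eq_one_of_coprime hlt (Nat.coprime_ordCompl hp hN).symm
  rw [← hpK, ← Nat.factorization_def N hp]
  conv_lhs => rw [← Nat.ordProj_mul_ordCompl_eq_self N p]
  rw [Nat.cast_mul, norm_mul, hu, mul_one, Nat.cast_pow, norm_pow]

theorem inv_le_norm_natCast (hp : p.Prime) (hpK : ‖(p : K)‖ = (p : ℝ)⁻¹)
    {N : ℕ} (hN : N ≠ 0) : (N : ℝ)⁻¹ ≤ ‖(N : K)‖ := by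
  rw [norm_natCast_eq_inv_pow_padicValNat hp hpK hN, inv_pow]
  have h : p ^ padicValNat p N ≤ N := Nat.le_of_dvd (Nat.pos_of_ne_zero hN) pow_padicValNat_dvd
  have h0 : 0 < p ^ padicValNat p N := pow_pos hp.pos _
  exact inv_anti₀ (by exact_mod_cast h0) (by exact_mod_cast h)

theorem inv_le_norm_intCast (hp : p.Prime) (hpK : ‖(p : K)‖ = (p : ℝ)⁻¹)
    {z : ℤ} (hz : z ≠ 0) : (|z| : ℝ)⁻¹ ≤ ‖(z : K)‖ := by
  have hnorm : ‖(z : K)‖ = ‖(z.natAbs : K)‖ := by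
    rcases Int.natAbs_eq z with h | h <;> conv_lhs => rw [h]
    · simp
    · simp
  rw [hnorm, ← Int.cast_abs, ← Nat.cast_natAbs]
  exact inv_le_norm_natCast hp hpK (Int.natAbs_ne_zero.mpr hz)

/-- If `γ ^ (p - 1) = 1 / p`, then `‖k!‖ = γ ^ (k - s)` with `s` the base-`p` digit sum of `k`. -/
theorem norm_factorial_eq_pow (hp : p.Prime) (hpK : ‖(p : K)‖ = (p : ℝ)⁻¹)
    {γ : ℝ} (hγ : γ ^ (p - 1) = (p : ℝ)⁻¹) (k : ℕ) :
    ‖(k.factorial : K)‖ = γ ^ (k - (p.digits k).sum) := by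
  have : Fact p.Prime := ⟨hp⟩
  rw [norm_natCast_eq_inv_pow_padicValNat hp hpK k.factorial_ne_zero, ← hγ, ← pow_mul,
    sub_one_mul_padicValNat_factorial]

theorem pow_le_norm_factorial (hp : p.Prime) (hpK : ‖(p : K)‖ = (p : ℝ)⁻¹)
    {γ : ℝ} (hγ0 : 0 ≤ γ) (hγ1 : γ ≤ 1) (hγ : γ ^ (p - 1) = (p : ℝ)⁻¹) (k : ℕ) :
    γ ^ k ≤ ‖(k.factorial : K)‖ := by
  rw [norm_factorial_eq_pow hp hpK hγ]
  exact pow_le_pow_of_le_one hγ0 hγ1 (Nat.sub_le _ _)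

theorem norm_factorial_le (hp : p.Prime) (hpK : ‖(p : K)‖ = (p : ℝ)⁻¹)
    {γ : ℝ} (hγ0 : 0 ≤ γ) (hγ1 : γ ≤ 1) (hγ : γ ^ (p - 1) = (p : ℝ)⁻¹) (k : ℕ) :
    ‖(k.factorial : K)‖ ≤ p * (k + 1) * γ ^ k := by
  have hp0 : (0 : ℝ) < p := by exact_mod_cast hp.pos
  rcases Nat.eq_zero_or_pos k with rfl | hk
  · have : (1 : ℝ) ≤ p := by exact_mod_cast hp.one_lt.le
    simpa using this
  have hlen : (p : ℝ) ^ (p.digits k).length ≤ p * k := by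
    exact_mod_cast Nat.base_pow_length_digits_le p k hp.one_lt hk.ne'
  have hsum : (p.digits k).sum ≤ (p - 1) * (p.digits k).length := by
    have h := List.sum_le_card_nsmul (p.digits k) (p - 1)
      fun x hx => Nat.le_sub_one_of_lt (Nat.digits_lt_base hp.one_lt hx)
    rwa [smul_eq_mul, mul_comm] at h
  have hs : 1 ≤ p * (k + 1) * γ ^ (p.digits k).sum := by
    calc (1 : ℝ) = (p : ℝ) ^ (p.digits k).length * ((p : ℝ)⁻¹) ^ (p.digits k).length := by
          rw [← mul_pow, mul_inv_cancel₀ hp0.ne', one_pow]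
      _ = (p : ℝ) ^ (p.digits k).length * γ ^ ((p - 1) * (p.digits k).length) := by
          rw [pow_mul, hγ]
      _ ≤ (p * (k + 1)) * γ ^ (p.digits k).sum := by
          refine mul_le_mul (hlen.trans ?_) (pow_le_pow_of_le_one hγ0 hγ1 hsum)
            (pow_nonneg hγ0 _) (by positivity)
          gcongr; linarith
  rw [norm_factorial_eq_pow hp hpK hγ]
  calc γ ^ (k - (p.digits k).sum)
      ≤ (p * (k + 1) * γ ^ (p.digits k).sum) * γ ^ (k - (p.digits k).sum) :=
        le_mul_of_one_le_left (pow_nonneg hγ0 _) hs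
    _ = p * (k + 1) * γ ^ k := by
        rw [mul_assoc, ← pow_add, Nat.add_sub_cancel' (Nat.digit_sum_le p k)]

theorem norm_prod_add_le_norm_factorial {x : K}
    (hx : x ∈ closure (Set.range (Int.cast : ℤ → K))) (k : ℕ) :
    ‖∏ j ∈ Finset.range k, (x + j)‖ ≤ ‖(k.factorial : K)‖ := by
  have hclosed : IsClosed {y : K | ‖∏ j ∈ Finset.range k, (y + j)‖ ≤ ‖(k.factorial : K)‖} :=
    isClosed_le (by fun_prop) continuous_const
  refine closure_minimal ?_ hclosed hx
  rintro _ ⟨z, rfl⟩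
  obtain ⟨w, hw⟩ := Nat.factorial_coe_dvd_prod k z
  have hw' : ∏ j ∈ Finset.range k, ((z : K) + j) = k.factorial * w := by
    exact_mod_cast congrArg (Int.cast : ℤ → K) hw
  change ‖∏ j ∈ Finset.range k, ((z : K) + j)‖ ≤ _
  rw [hw', norm_mul]
  exact mul_le_of_le_one_right (norm_nonneg _) (IsUltrametricDist.norm_intCast_le_one K w)

theorem mul_norm_factorial_le_norm_prod_add {x : K} {δ : ℝ} (hδ1 : δ ≤ 1) (k : ℕ)
    (hδ : ∀ j < k, δ ≤ ‖x + j‖) :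
    δ * ‖(k.factorial : K)‖ ≤ ‖∏ j ∈ Finset.range k, (x + j)‖ := by
  rcases Nat.eq_zero_or_pos k with rfl | hk
  · simpa using hδ1
  obtain ⟨a, ha, hmin⟩ := Finset.exists_min_image (Finset.range k) (fun j : ℕ => ‖x + j‖)
    ⟨0, Finset.mem_range.mpr hk⟩
  rw [Finset.mem_range] at ha
  obtain ⟨r, rfl⟩ : ∃ r, k = a + (1 + r) := ⟨k - a - 1, by omega⟩
  have hdiff : ∀ j < a + (1 + r), ‖(j : K) - a‖ ≤ ‖x + j‖ := fun j hj => by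
    have h1 : (j : K) - a = (x + j) + -(x + a) := by ring
    rw [h1]
    refine (IsUltrametricDist.norm_add_le_max _ _).trans (max_le le_rfl ?_)
    rw [norm_neg]
    exact hmin j (Finset.mem_range.mpr hj)
  have hleft : ‖(a.factorial : K)‖ ≤ ∏ j ∈ Finset.range a, ‖x + j‖ := by
    rw [← Finset.prod_range_add_one_eq_factorial, Nat.cast_prod, norm_prod,
      ← Finset.prod_range_reflect]
    refine Finset.prod_le_prod (fun _ _ => norm_nonneg _) fun j hj => ?_
    rw [Finset.mem_range] at hj
    refine le_trans (le_of_eq ?_) (hdiff j (by omega))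
    rw [norm_sub_rev, ← Nat.cast_sub hj.le]
    congr 2
    omega
  have hright : ‖(r.factorial : K)‖ ≤ ∏ j ∈ Finset.range r, ‖x + (a + (1 + j) : ℕ)‖ := by
    rw [← Finset.prod_range_add_one_eq_factorial, Nat.cast_prod, norm_prod]
    refine Finset.prod_le_prod (fun _ _ => norm_nonneg _) fun j hj => ?_
    rw [Finset.mem_range] at hj
    refine le_trans (le_of_eq ?_) (hdiff (a + (1 + j)) (by omega))
    congr 1
    push_cast
    ring
  have hfact : ‖((a + (1 + r)).factorial : K)‖ ≤ ‖(a.factorial : K)‖ * ‖(r.factorial : K)‖ := by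
    obtain ⟨w, hw⟩ : a.factorial * r.factorial ∣ (a + (1 + r)).factorial :=
      (Nat.factorial_mul_factorial_dvd_factorial_add a r).trans
        (Nat.factorial_dvd_factorial (by omega))
    rw [hw, Nat.cast_mul, Nat.cast_mul, norm_mul, norm_mul]
    exact mul_le_of_le_one_right (by positivity) (IsUltrametricDist.norm_natCast_le_one K w)
  rw [norm_prod, Finset.prod_range_add, Finset.prod_range_add, Finset.prod_range_one, add_zero]
  calc δ * ‖((a + (1 + r)).factorial : K)‖
      ≤ ‖x + a‖ * (‖(a.factorial : K)‖ * ‖(r.factorial : K)‖) :=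
        mul_le_mul (hδ a ha) hfact (norm_nonneg _) (norm_nonneg _)
    _ ≤ ‖x + a‖ * ((∏ j ∈ Finset.range a, ‖x + j‖) *
          ∏ j ∈ Finset.range r, ‖x + (a + (1 + j) : ℕ)‖) := by
        gcongr
    _ = _ := by ring

theorem intCast_div_mem_closure_range_intCast {q : ℕ} (hq : ‖(q : K)‖ < 1) (z : ℤ) :
    (z : K) / (q - 1) ∈ closure (Set.range (Int.cast : ℤ → K)) := by
  have hq1 : (q : K) ≠ 1 := fun h => by simp [h] at hq
  have hlim : Filter.Tendsto (fun M : ℕ => (z : K) / (q - 1) * (1 - (q : K) ^ M)) Filter.atTop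
      (nhds ((z : K) / (q - 1) * (1 - 0))) :=
    (tendsto_const_nhds.sub (tendsto_pow_atTop_nhds_zero_of_norm_lt_one hq)).const_mul _
  rw [sub_zero, mul_one] at hlim
  refine mem_closure_of_tendsto hlim (Filter.Eventually.of_forall fun M => ?_)
  refine ⟨-z * ∑ i ∈ Finset.range M, (q : ℤ) ^ i, ?_⟩
  push_cast
  rw [geom_sum_eq hq1]
  ring

end Ultrametric

theorem eq_zero_of_le_mul_pow {a B η : ℝ} (ha : 0 ≤ a) (hη0 : 0 < η) (hη1 : η < 1) (d : ℕ)
    (h : ∀ k : ℕ, a ≤ B * ((k + 1 : ℝ) ^ d * η ^ k)) : a = 0 := by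
  have hlim := ((tendsto_pow_const_mul_const_pow_of_abs_lt_one d
    (abs_lt.mpr ⟨by linarith, hη1⟩)).comp (Filter.tendsto_add_atTop_nat 1)).const_mul (B / η)
  rw [mul_zero] at hlim
  refine le_antisymm (ge_of_tendsto' hlim fun k => (h k).trans_eq ?_) ha
  simp only [Function.comp_apply, Nat.cast_add, Nat.cast_one, pow_succ]
  field_simp

/-- The growth-estimate step in Proposition 3.5(ii): for `|π| = p^{-1/(p-1)}`,
non-integer `α_i ∈ (1/(q-1))ℤ` and `β_j ∈ (1/(q-1))ℤ`, any sequence `(c_l)` with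
`|c_l| < Cη^l` (`η < 1`) satisfying the hypergeometric recursion
`c_l·∏ᵢ(l-αᵢ) = (-1)^{m+np} π^{m-n} c_{l+1}·∏ⱼ(l-βⱼ)` vanishes identically. -/
theorem hyp_recursion_vanishes (p s q : ℕ) (hp : p.Prime) (hs : 0 < s) (hq : q = p ^ s)
    (K : Type*) [NormedField K] [CompleteSpace K] [CharZero K]
    (hna : IsNonarchimedean (fun a : K => ‖a‖))
    (hpnorm : ‖(p : K)‖ = ((p : ℝ))⁻¹)
    {m n : ℕ} (α : Fin m → ℚ) (β : Fin n → ℚ)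
    (hαq : ∀ i, ∃ z : ℤ, α i = (z : ℚ) / ((q : ℚ) - 1))
    (hβq : ∀ j, ∃ z : ℤ, β j = (z : ℚ) / ((q : ℚ) - 1))
    (hαint : ∀ i, ∀ z : ℤ, α i ≠ (z : ℚ))
    (π : K) (hπ : ‖π‖ = (p : ℝ) ^ (-(1 : ℝ) / ((p : ℝ) - 1)))
    (c : ℕ → K)
    (hgrow : ∃ C : ℝ, 0 < C ∧ ∃ η : ℝ, η < 1 ∧ ∀ l : ℕ, ‖c l‖ < C * η ^ l)
    (hrec : ∀ l : ℕ,
      c l * ∏ i, ((l : K) - ((α i : ℚ) : K))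
        = (-1 : K) ^ (m + n * p) * π ^ ((m : ℤ) - (n : ℤ))
            * (c (l + 1) * ∏ j, ((l : K) - ((β j : ℚ) : K)))) :
    ∀ l, c l = 0 := by
  have : IsUltrametricDist K := IsUltrametricDist.isUltrametricDist_of_isNonarchimedean_norm hna
  have hp0 : (0 : ℝ) < p := by exact_mod_cast hp.pos
  have hp1 : (1 : ℝ) < p := by exact_mod_cast hp.one_lt
  have hγ0 : 0 < ‖π‖ := hπ ▸ Real.rpow_pos_of_pos hp0 _
  have hγ : ‖π‖ ^ (p - 1) = (p : ℝ)⁻¹ := by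
    rw [hπ, ← Real.rpow_natCast, ← Real.rpow_mul hp0.le, Nat.cast_sub hp.one_lt.le, Nat.cast_one,
      div_mul_cancel₀ _ (by linarith), Real.rpow_neg_one]
  have hγ1 : ‖π‖ ≤ 1 := by
    rw [hπ]
    exact Real.rpow_le_one_of_one_le_of_nonpos hp1.le
      (div_nonpos_of_nonpos_of_nonneg (by norm_num) (by linarith))
  have hqlt : ‖(q : K)‖ < 1 := by
    rw [hq, Nat.cast_pow, norm_pow, hpnorm]
    exact pow_lt_one₀ (by positivity) (inv_lt_one_of_one_lt₀ hp1) hs.ne'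
  have hq2 : 1 < q := hq ▸ Nat.one_lt_pow hs.ne' hp.one_lt
  have hqK : (q : K) - 1 ≠ 0 := sub_ne_zero.mpr (by exact_mod_cast hq2.ne')
  have hqQ : (q : ℚ) - 1 ≠ 0 := sub_ne_zero.mpr (by exact_mod_cast hq2.ne')
  choose a ha using hαq
  choose b hb using hβq
  obtain ⟨C, hC, η, hη1, hη⟩ := hgrow
  have hη0 : 0 < η := by
    have h := (norm_nonneg _).trans_lt (hη 1)
    rw [pow_one] at h
    exact pos_of_mul_pos_right h hC.le
  have hstep : ∀ l : ℕ, ‖c l‖ * (∏ i, ‖(l : K) - ((α i : ℚ) : K)‖) * ‖π‖ ^ n =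
      ‖c (l + 1)‖ * (∏ i, ‖(l : K) - ((β i : ℚ) : K)‖) * ‖π‖ ^ m := fun l => by
    have h := congrArg norm (hrec l)
    simp only [norm_mul, norm_pow, norm_neg, norm_one, one_pow, one_mul, norm_zpow,
      norm_prod] at h
    rw [h, zpow_sub₀ hγ0.ne', zpow_natCast, zpow_natCast]
    field_simp
  intro l
  have hiter : ∀ k : ℕ,
      ‖c l‖ * (∏ i, ‖∏ j ∈ Finset.range k, ((l : K) - ((α i : ℚ) : K) + j)‖) * (‖π‖ ^ k) ^ n =
        ‖c (l + k)‖ * (∏ i, ‖∏ j ∈ Finset.range k, ((l : K) - ((β i : ℚ) : K) + j)‖)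
          * (‖π‖ ^ k) ^ m := by
    intro k
    induction k with
    | zero => simp
    | succ k ih =>
      have h := hstep (l + k)
      have hsplit : ∀ {r : ℕ} (θ : Fin r → ℚ),
          (∏ i, ‖∏ j ∈ Finset.range (k + 1), ((l : K) - ((θ i : ℚ) : K) + j)‖) =
            (∏ i, ‖∏ j ∈ Finset.range k, ((l : K) - ((θ i : ℚ) : K) + j)‖) *
              ∏ i, ‖((l + k : ℕ) : K) - ((θ i : ℚ) : K)‖ := fun θ => by
        rw [← Finset.prod_mul_distrib]
        refine Finset.prod_congr rfl fun i _ => ?_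
        rw [Finset.prod_range_succ, norm_mul, Nat.cast_add, sub_add_eq_add_sub]
      rw [hsplit, hsplit, ← add_assoc]
      simp only [pow_succ, mul_pow]
      linear_combination (∏ i, ‖((l + k : ℕ) : K) - ((α i : ℚ) : K)‖) * ‖π‖ ^ n * ih +
        (∏ i, ‖∏ j ∈ Finset.range k, ((l : K) - ((β i : ℚ) : K) + j)‖) * (‖π‖ ^ k) ^ m * h
  have hshift : ∀ (θ : ℚ) (z : ℤ), θ = z / ((q : ℚ) - 1) → ∀ j : ℕ,
      (l : K) - (θ : K) + j = (((l + j : ℕ) * ((q : ℤ) - 1) - z : ℤ) : K) / (q - 1) := by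
    rintro _ z rfl j
    push_cast
    field_simp
    ring
  let E : Fin m → ℝ := fun i => (l + 1) * (q - 1) + |(a i : ℝ)|
  have hq1R : (1 : ℝ) ≤ q - 1 := by
    have : (2 : ℝ) ≤ q := by exact_mod_cast hq2
    linarith
  have hE : ∀ i, 1 ≤ E i := fun i => by
    have h1 : (0 : ℝ) ≤ l * (q - 1) := by positivity
    have h2 := abs_nonneg (a i : ℝ)
    simp only [E]
    nlinarith
  have hlower : ∀ i (k : ℕ), (E i * (k + 1 : ℝ))⁻¹ * ‖π‖ ^ k ≤
      ‖∏ j ∈ Finset.range k, ((l : K) - ((α i : ℚ) : K) + j)‖ := fun i k => by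
    have hEk : 1 ≤ E i * (k + 1) :=
      one_le_mul_of_one_le_of_one_le (hE i) (le_add_of_nonneg_left k.cast_nonneg)
    refine (mul_le_mul_of_nonneg_left (pow_le_norm_factorial hp hpnorm hγ0.le hγ1 hγ k)
      (inv_nonneg.mpr (one_pos.le.trans hEk))).trans ?_
    refine mul_norm_factorial_le_norm_prod_add (inv_le_one_of_one_le₀ hEk) k
      fun j hj => ?_
    have hne : ((l + j : ℕ) * ((q : ℤ) - 1) - a i : ℤ) ≠ 0 := fun h => by
      refine hαint i (l + j : ℕ) ?_
      rw [ha i, div_eq_iff hqQ]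
      exact_mod_cast (sub_eq_zero.mp h).symm
    have hqn : ‖(q : K) - 1‖ ≤ 1 := by
      exact_mod_cast IsUltrametricDist.norm_intCast_le_one K ((q : ℤ) - 1)
    rw [hshift (α i) (a i) (ha i) j, norm_div]
    refine le_trans ?_ (le_div_self (norm_nonneg _) (norm_pos_iff.mpr hqK) hqn)
    refine le_trans ?_ (inv_le_norm_intCast hp hpnorm hne)
    refine inv_anti₀ (abs_pos.mpr (by exact_mod_cast hne)) ?_
    push_cast
    refine (abs_sub _ _).trans ?_
    have hjk : (j : ℝ) ≤ k := by exact_mod_cast hj.le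
    have hl0 : (0 : ℝ) ≤ l := l.cast_nonneg
    have hk0 : (0 : ℝ) ≤ k := k.cast_nonneg
    rw [abs_of_nonneg (by positivity)]
    have h1 : (l + j : ℝ) * (q - 1) ≤ (l + 1) * (k + 1) * (q - 1) := by
      gcongr
      nlinarith
    have h2 : |(a i : ℝ)| ≤ |(a i : ℝ)| * (k + 1) := le_mul_of_one_le_right (abs_nonneg _)
      (by linarith)
    simp only [E]
    linarith
  have hupper : ∀ i k, ‖∏ j ∈ Finset.range k, ((l : K) - ((β i : ℚ) : K) + j)‖ ≤
      p * (k + 1) * ‖π‖ ^ k := fun i k => by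
    refine (norm_prod_add_le_norm_factorial ?_ k).trans
      (norm_factorial_le hp hpnorm hγ0.le hγ1 hγ k)
    have h := hshift (β i) (b i) (hb i) 0
    rw [Nat.cast_zero, add_zero] at h
    rw [h]
    exact intCast_div_mem_closure_range_intCast hqlt _
  rw [← norm_eq_zero]
  have hEpos : ∀ i, 0 < E i := fun i => one_pos.trans_le (hE i)
  refine eq_zero_of_le_mul_pow (B := (∏ i, E i) * C * p ^ n * η ^ l) (norm_nonneg _) hη0 hη1 (m + n)
    fun k => ?_
  have hA : (∏ i, E i)⁻¹ * ((k + 1 : ℝ) ^ m)⁻¹ * (‖π‖ ^ k) ^ m ≤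
      ∏ i, ‖∏ j ∈ Finset.range k, ((l : K) - ((α i : ℚ) : K) + j)‖ := by
    have hnonneg : ∀ i, 0 ≤ (E i * (k + 1 : ℝ))⁻¹ * ‖π‖ ^ k := fun i =>
      mul_nonneg (inv_nonneg.mpr (mul_nonneg (hEpos i).le (by positivity))) (by positivity)
    refine le_trans (le_of_eq ?_) (Finset.prod_le_prod (fun i _ => hnonneg i) fun i _ => hlower i k)
    simp [Finset.prod_mul_distrib, mul_comm]
  have hB : ∏ i, ‖∏ j ∈ Finset.range k, ((l : K) - ((β i : ℚ) : K) + j)‖ ≤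
      (p * (k + 1) * ‖π‖ ^ k) ^ n :=
    (Finset.prod_le_prod (fun _ _ => norm_nonneg _) fun i _ => hupper i k).trans_eq (by simp)
  have hP : 0 < ∏ i, E i := Finset.prod_pos fun i _ => hEpos i
  have hmain : ‖c l‖ * ((∏ i, E i)⁻¹ * ((k + 1 : ℝ) ^ m)⁻¹ * (‖π‖ ^ k) ^ m) * (‖π‖ ^ k) ^ n ≤
      C * η ^ (l + k) * (p * (k + 1) * ‖π‖ ^ k) ^ n * (‖π‖ ^ k) ^ m := by
    calc _ ≤ _ := by gcongr
      _ = _ := hiter k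
      _ ≤ _ := by gcongr; exact (hη _).le
  generalize ∏ i, E i = P at hP hmain ⊢
  have hG : 0 < (‖π‖ ^ k) ^ m * (‖π‖ ^ k) ^ n := by positivity
  refine le_of_mul_le_mul_right ?_ hG
  calc _ = (P * (k + 1 : ℝ) ^ m) *
        (‖c l‖ * (P⁻¹ * ((k + 1 : ℝ) ^ m)⁻¹ * (‖π‖ ^ k) ^ m) * (‖π‖ ^ k) ^ n) := by field_simp
    _ ≤ (P * (k + 1 : ℝ) ^ m) *
        (C * η ^ (l + k) * (p * (k + 1) * ‖π‖ ^ k) ^ n * (‖π‖ ^ k) ^ m) := by gcongr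
    _ = _ := by rw [pow_add, pow_add, mul_pow, mul_pow]; ring
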